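/- Let (Y,Σ,ν) be a σ-finite measure space and let Q be a bounded linear operator on the complex Hilbert space L²(Y). Then Q is a multiplication operator if and only if there exists a constant c > 0 such that |Qf| ≤ c·|f| almost everywhere for every f ∈ L²(Y). -/

import Mathlib

open MeasureTheory

/-- `Q` is a multiplication operator on `L²(Y)`: there is an essentially bounded
measurable function `m : Y → ℂ` with `Q f = m • f` a.e. for every `f`. -/
def IsMultiplicationOperator {Y : Type*} [MeasurableSpace Y] (ν : Measure Y)
    (Q : Lp ℂ 2 ν →L[ℂ] Lp ℂ 2 ν) : Prop :=
  ∃ m : Y → ℂ, Measurable m ∧ (∃ M : ℝ, ∀ᵐ y ∂ν, ‖m y‖ ≤ M) ∧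
    ∀ f : Lp ℂ 2 ν, ⇑(Q f) =ᵐ[ν] fun y => m y * f y

/-- On a `σ`-finite measure space there is an `L²` function vanishing almost nowhere. -/
theorem exists_Lp_two_ae_ne_zero {Y : Type*} [MeasurableSpace Y] (ν : Measure Y) [SigmaFinite ν] :
    ∃ h : Lp ℂ 2 ν, ∀ᵐ y ∂ν, h y ≠ 0 := by
  obtain ⟨g, g_pos, g_meas, g_int⟩ :=
    exists_pos_lintegral_lt_of_sigmaFinite ν (ε := 1) one_ne_zero
  have h_meas : Measurable fun y => ((√(g y : ℝ) : ℝ) : ℂ) := by fun_prop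
  have h_mem : MemLp (fun y => ((√(g y : ℝ) : ℝ) : ℂ)) 2 ν := by
    rw [memLp_two_iff_integrable_sq_norm h_meas.aestronglyMeasurable]
    have h_sq : ∀ y, ‖((√(g y : ℝ) : ℝ) : ℂ)‖ ^ 2 = g y := fun y => by
      rw [Complex.norm_real, Real.norm_eq_abs, sq_abs, Real.sq_sqrt (g y).coe_nonneg]
    simp only [h_sq]
    refine ⟨g_meas.coe_nnreal_real.aestronglyMeasurable, ?_⟩
    simpa [HasFiniteIntegral, enorm_eq_nnnorm] using g_int.trans ENNReal.one_lt_top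
  refine ⟨h_mem.toLp _, ?_⟩
  filter_upwards [h_mem.coeFn_toLp] with y hy
  rw [hy, Complex.ofReal_ne_zero]
  exact (Real.sqrt_pos.2 (g_pos y)).ne'

/-- An operator satisfying `|Q f| ≤ c |f|` is determined by its value at a single function. -/
theorem ae_eq_div_mul_of_domination {Y : Type*} [MeasurableSpace Y] {ν : Measure Y}
    {Q : Lp ℂ 2 ν →L[ℂ] Lp ℂ 2 ν} {c : ℝ}
    (hQ : ∀ f : Lp ℂ 2 ν, ∀ᵐ y ∂ν, ‖Q f y‖ ≤ c * ‖f y‖) (f h : Lp ℂ 2 ν) :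
    ∀ᵐ y ∂ν, h y ≠ 0 → Q f y = Q h y / h y * f y := by
  have h_dense : ∀ᵐ y ∂ν, ∀ n : ℕ,
      ‖Q f y - TopologicalSpace.denseSeq ℂ n * Q h y‖ ≤
        c * ‖f y - TopologicalSpace.denseSeq ℂ n * h y‖ := by
    refine ae_all_iff.2 fun n => ?_
    set a := TopologicalSpace.denseSeq ℂ n
    have hQa : Q (f - a • h) = Q f - a • Q h := by simp
    filter_upwards [hQ (f - a • h), Lp.coeFn_sub f (a • h), Lp.coeFn_smul a h,
      Lp.coeFn_sub (Q f) (a • Q h), Lp.coeFn_smul a (Q h)] with y hy h₁ h₂ h₃ h₄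
    rw [hQa, h₁, h₃, Pi.sub_apply, Pi.sub_apply, h₂, h₄] at hy
    simpa using hy
  filter_upwards [h_dense] with y hy hne
  have h_all : ∀ a : ℂ, ‖Q f y - a * Q h y‖ ≤ c * ‖f y - a * h y‖ := fun a =>
    (TopologicalSpace.denseRange_denseSeq ℂ).induction_on a
      (isClosed_le (by fun_prop) (by fun_prop)) hy
  have h_zero := h_all (f y / h y)
  rw [div_mul_cancel₀ _ hne, sub_self, norm_zero, mul_zero, norm_le_zero_iff, sub_eq_zero]
    at h_zero
  rw [h_zero]
  ring

/-- `Q` is a multiplication operator iff there is a constant `c > 0` such that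
`|Q f| ≤ c |f|` a.e. for every `f ∈ L²(Y)`. -/
theorem multiplication_iff_domination {Y : Type*} [MeasurableSpace Y]
    (ν : Measure Y) [SigmaFinite ν] (Q : Lp ℂ 2 ν →L[ℂ] Lp ℂ 2 ν) :
    IsMultiplicationOperator ν Q ↔
      ∃ c : ℝ, 0 < c ∧ ∀ f : Lp ℂ 2 ν, ∀ᵐ y ∂ν, ‖Q f y‖ ≤ c * ‖f y‖ := by
  constructor
  · rintro ⟨m, -, ⟨M, hM⟩, hQ⟩
    refine ⟨max M 1, by positivity, fun f => ?_⟩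
    filter_upwards [hM, hQ f] with y hy hf
    rw [hf, norm_mul]
    gcongr
    exact hy.trans (le_max_left _ _)
  · rintro ⟨c, -, hQ⟩
    obtain ⟨h, h_ne⟩ := exists_Lp_two_ae_ne_zero ν
    refine ⟨fun y => Q h y / h y, (Lp.stronglyMeasurable _).measurable.div
      (Lp.stronglyMeasurable _).measurable, ⟨c, ?_⟩, fun f => ?_⟩
    · filter_upwards [h_ne, hQ h] with y hne hy
      rwa [norm_div, div_le_iff₀ (norm_pos_iff.2 hne)]
    · filter_upwards [h_ne, ae_eq_div_mul_of_domination hQ f h] with y hne hy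
      exact hy hne
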